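/- Let σ, σ_x, σ_p > 0, θ* ∈ ℝ^d, and let c = σ_p² σ_x² / σ². Let θ ∼ N(0, σ_p² I_d) and, independently, (x,y) ∼ P, where P is such that y = θ*ᵀx + ε with ε ∼ N(0,σ²) independent of x, x has mean zero and E[x xᵀ] = σ_x² I_d. Then for every t with 0 < t < 1/c, setting s² = (1/t)( c d − c t + 1 + σ_x² ‖θ*‖² / σ² ), the cumulant generating function of the Gaussian negative log-likelihood loss satisfies log E[ exp( t ( R(θ) − ℓ(θ,(x,y)) ) ) ] ≤ s² t² / (2(1 − c t)), where R(θ) = E_{(x,y)∼P}[ℓ(θ,(x,y))]. That is, the standard loss is sub-gamma with variance s² and scale c. -/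

import Mathlib

open MeasureTheory ProbabilityTheory Matrix

/-- Tilting a centred Gaussian density by `exp (a (m - z)²)` gives a multiple of another Gaussian
density. -/
lemma exp_sq_mul_gaussianPDFReal {a m : ℝ} {v : NNReal} (hv : v ≠ 0) (h : 2 * a * v < 1) (z : ℝ) :
    gaussianPDFReal 0 v z * Real.exp (a * (m - z) ^ 2)
      = (√(1 - 2 * a * v))⁻¹ * Real.exp (a * m ^ 2 / (1 - 2 * a * v))
        * gaussianPDFReal (-(2 * a * m * v) / (1 - 2 * a * v))
          (v / (1 - 2 * a * v)).toNNReal z := by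
  have hD : 0 < 1 - 2 * a * v := by linarith
  have hs : (0 : ℝ) < v := by positivity
  set D := 1 - 2 * a * v with hDdef
  have hv1 : ((v / D).toNNReal : ℝ) = v / D := Real.coe_toNNReal _ (by positivity)
  have hsqrt : √(2 * Real.pi * (v / D)) = √(2 * Real.pi * v) / √D := by
    rw [← mul_div_assoc, Real.sqrt_div (by positivity)]
  have hD' : √D ≠ 0 := (Real.sqrt_pos.2 hD).ne'
  have hN : √(2 * Real.pi * v) ≠ 0 := (Real.sqrt_pos.2 (by positivity)).ne'
  simp only [gaussianPDFReal, hv1, hsqrt]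
  rw [mul_assoc, ← Real.exp_add]
  have hexp : -(z - 0) ^ 2 / (2 * v) + a * (m - z) ^ 2
      = a * m ^ 2 / D + -(z - -(2 * a * m * v) / D) ^ 2 / (2 * (v / D)) := by
    have hDne := hD.ne'
    field_simp
    rw [hDdef]
    ring
  rw [hexp, Real.exp_add]
  field_simp

lemma integral_exp_sq_gaussianReal {a m : ℝ} {v : NNReal} (hv : v ≠ 0) (h : 2 * a * v < 1) :
    ∫ z, Real.exp (a * (m - z) ^ 2) ∂(gaussianReal 0 v)
      = (√(1 - 2 * a * v))⁻¹ * Real.exp (a * m ^ 2 / (1 - 2 * a * v)) := by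
  have hD : 0 < 1 - 2 * a * v := by linarith
  have hs : (0 : ℝ) < v := by positivity
  have hv' : (v / (1 - 2 * a * v)).toNNReal ≠ 0 :=
    (Real.toNNReal_pos.2 (by positivity)).ne'
  rw [integral_gaussianReal_eq_integral_smul hv]
  simp only [smul_eq_mul, exp_sq_mul_gaussianPDFReal hv h]
  rw [integral_const_mul, integral_gaussianPDFReal_eq_one _ hv', mul_one]

lemma integral_exp_sum_sq_pi_gaussianReal {d : ℕ} {a : ℝ} {v : NNReal} (m : Fin d → ℝ) (hv : v ≠ 0)
    (h : 2 * a * v < 1) :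
    ∫ θ, Real.exp (a * ∑ i, (m i - θ i) ^ 2)
        ∂(Measure.pi fun _ : Fin d => gaussianReal 0 v)
      = ((√(1 - 2 * a * v))⁻¹) ^ d
        * Real.exp (a * (∑ i, m i ^ 2) / (1 - 2 * a * v)) := by
  simp only [Finset.mul_sum, Real.exp_sum]
  rw [integral_fintype_prod_eq_prod (fun i z => Real.exp (a * (m i - z) ^ 2))]
  simp only [integral_exp_sq_gaussianReal hv h]
  rw [Finset.prod_mul_distrib, Finset.prod_const, Finset.card_univ, Fintype.card_fin,
    Finset.sum_div, Real.exp_sum]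

section SecondMoments

variable {d : ℕ} {τ : ℝ} {Px : Measure (Fin d → ℝ)}

lemma memLp_two_eval_of_integral_mul_eq (hτ : τ ≠ 0)
    (hcov : ∀ i j, ∫ x, x i * x j ∂Px = if i = j then τ ^ 2 else 0) (i : Fin d) :
    MemLp (fun x => x i) 2 Px := by
  rw [memLp_two_iff_integrable_sq (measurable_pi_apply i).aestronglyMeasurable]
  refine .of_integral_ne_zero ?_
  simp only [sq, hcov i i, if_true]
  exact mul_ne_zero hτ hτ

lemma memLp_two_dotProduct (h : ∀ i, MemLp (fun x => x i) 2 Px) (w : Fin d → ℝ) :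
    MemLp (fun x => w ⬝ᵥ x) 2 Px := by
  simp only [dotProduct]
  exact memLp_finsetSum _ fun i _ => (h i).const_mul (w i)

lemma integral_dotProduct_eq_zero (h : ∀ i, Integrable (fun x => x i) Px)
    (hmean : ∀ i, ∫ x, x i ∂Px = 0) (w : Fin d → ℝ) : ∫ x, w ⬝ᵥ x ∂Px = 0 := by
  simp only [dotProduct]
  rw [integral_finsetSum _ fun i _ => (h i).const_mul (w i)]
  simp [integral_const_mul, hmean]

lemma integral_dotProduct_sq (hτ : τ ≠ 0)
    (hcov : ∀ i j, ∫ x, x i * x j ∂Px = if i = j then τ ^ 2 else 0) (w : Fin d → ℝ) :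
    ∫ x, (w ⬝ᵥ x) ^ 2 ∂Px = τ ^ 2 * ∑ i, w i ^ 2 := by
  have hL := memLp_two_eval_of_integral_mul_eq hτ hcov
  have hI : ∀ i j, Integrable (fun x => w i * w j * (x i * x j)) Px := fun i j =>
    ((hL i).integrable_mul (hL j)).const_mul _
  have hexp : ∀ x : Fin d → ℝ, (w ⬝ᵥ x) ^ 2 = ∑ i, ∑ j, w i * w j * (x i * x j) := by
    intro x
    rw [sq, dotProduct, Finset.sum_mul_sum]
    exact Finset.sum_congr rfl fun i _ => Finset.sum_congr rfl fun j _ => by ring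
  simp only [hexp]
  rw [integral_finsetSum _ fun i _ => integrable_finsetSum _ fun j _ => hI i j, Finset.mul_sum]
  refine Finset.sum_congr rfl fun i _ => ?_
  rw [integral_finsetSum _ fun j _ => hI i j]
  simp only [integral_const_mul, hcov, mul_ite, mul_zero, Finset.sum_ite_eq, Finset.mem_univ,
    if_true]
  ring

variable [IsProbabilityMeasure Px]

/-- Mean squared residual of a linear model with independent centred Gaussian noise. -/
lemma integrable_and_integral_sq_dotProduct_add (hτ : τ ≠ 0) (hmean : ∀ i, ∫ x, x i ∂Px = 0)
    (hcov : ∀ i j, ∫ x, x i * x j ∂Px = if i = j then τ ^ 2 else 0) (v : NNReal)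
    (w : Fin d → ℝ) :
    Integrable (fun p : (Fin d → ℝ) × ℝ => (w ⬝ᵥ p.1 + p.2) ^ 2) (Px.prod (gaussianReal 0 v)) ∧
      ∫ p, (w ⬝ᵥ p.1 + p.2) ^ 2 ∂(Px.prod (gaussianReal 0 v)) = τ ^ 2 * (∑ i, w i ^ 2) + v := by
  have hL := memLp_two_eval_of_integral_mul_eq hτ hcov
  have hw := memLp_two_dotProduct hL w
  have hε : MemLp (fun z : ℝ => z) 2 (gaussianReal 0 v) := memLp_id_gaussianReal 2
  have h1 : Integrable (fun p : (Fin d → ℝ) × ℝ => (w ⬝ᵥ p.1) ^ 2)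
      (Px.prod (gaussianReal 0 v)) := hw.integrable_sq.comp_fst _
  have h2 : Integrable (fun p : (Fin d → ℝ) × ℝ => 2 * ((w ⬝ᵥ p.1) * p.2))
      (Px.prod (gaussianReal 0 v)) :=
    ((hw.integrable one_le_two).mul_prod (hε.integrable one_le_two)).const_mul 2
  have h3 : Integrable (fun p : (Fin d → ℝ) × ℝ => p.2 ^ 2)
      (Px.prod (gaussianReal 0 v)) := hε.integrable_sq.comp_snd _
  have h12 : Integrable (fun p : (Fin d → ℝ) × ℝ => (w ⬝ᵥ p.1) ^ 2 + 2 * ((w ⬝ᵥ p.1) * p.2))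
      (Px.prod (gaussianReal 0 v)) := h1.add h2
  have hexp : ∀ p : (Fin d → ℝ) × ℝ, (w ⬝ᵥ p.1 + p.2) ^ 2
      = (w ⬝ᵥ p.1) ^ 2 + 2 * ((w ⬝ᵥ p.1) * p.2) + p.2 ^ 2 := fun p => by ring
  have hvar : ∫ z, z ^ 2 ∂(gaussianReal 0 v) = v := by
    have := variance_of_integral_eq_zero (X := fun z : ℝ => z) (μ := gaussianReal 0 v)
      (by fun_prop) (by simp)
    rw [← this, variance_fun_id_gaussianReal]
  simp only [hexp]
  refine ⟨h12.add h3, ?_⟩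
  rw [integral_add h12 h3, integral_add h1 h2, integral_const_mul,
    integral_prod_mul (fun x : Fin d → ℝ => w ⬝ᵥ x) (fun z : ℝ => z),
    integral_dotProduct_eq_zero (fun i => (hL i).integrable one_le_two) hmean,
    integral_fun_fst (fun x : Fin d → ℝ => (w ⬝ᵥ x) ^ 2), integral_fun_snd (fun z : ℝ => z ^ 2),
    integral_dotProduct_sq hτ hcov, hvar]
  simp

end SecondMoments

/-- The elementary inequality `(1 - u)^(-1/2) ≤ exp (u / (2 (1 - u)))`. -/
lemma inv_sqrt_one_sub_le_exp {u : ℝ} (hu : u < 1) :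
    (√(1 - u))⁻¹ ≤ Real.exp (u / (2 * (1 - u))) := by
  have hD : 0 < 1 - u := by linarith
  rw [← Real.sqrt_inv, Real.sqrt_le_left (Real.exp_pos _).le, ← Real.exp_nat_mul]
  refine le_trans (le_of_eq ?_) (Real.add_one_le_exp _)
  push_cast
  field_simp
  ring

/-- Sub-gamma CGF bound for the standard Gaussian NLL loss: with prior
`θ ∼ N(0, σ_p² I_d)`, data `(x,y) ∼ P` where `y = θ*ᵀx + ε`, `ε ∼ N(0,σ²)`
independent of `x`, `E[x] = 0` and `E[xxᵀ] = σ_x² I_d`, and `c = σ_p²σ_x²/σ²`,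
for every `0 < t < 1/c`, with `s² = (1/t)(cd − ct + 1 + σ_x²‖θ*‖²/σ²)`,
`log E[exp(t(R(θ) − ℓ(θ,(x,y))))] ≤ s²t²/(2(1 − ct))`. -/
theorem cgf_bound_standard_loss
    (d : ℕ) (σ σx σp : ℝ) (hσ : 0 < σ) (hσx : 0 < σx) (hσp : 0 < σp)
    (θstar : Fin d → ℝ) (c : ℝ) (hc : c = σp ^ 2 * σx ^ 2 / σ ^ 2)
    (Px : Measure (Fin d → ℝ)) [IsProbabilityMeasure Px]
    (hmean : ∀ i, ∫ x, x i ∂Px = 0)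
    (hcov : ∀ i j, ∫ x, x i * x j ∂Px = if i = j then σx ^ 2 else 0)
    (P : Measure ((Fin d → ℝ) × ℝ))
    (hP : P = (Px.prod (gaussianReal 0 ⟨σ ^ 2, sq_nonneg σ⟩)).map
      fun p => (p.1, θstar ⬝ᵥ p.1 + p.2))
    (prior : Measure (Fin d → ℝ))
    (hprior : prior = Measure.pi fun _ : Fin d => gaussianReal 0 ⟨σp ^ 2, sq_nonneg σp⟩)
    (ℓ : (Fin d → ℝ) → ((Fin d → ℝ) × ℝ) → ℝ)
    (hℓ : ℓ = fun θ p => (1 / 2) * Real.log (2 * Real.pi * σ ^ 2)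
      + (1 / (2 * σ ^ 2)) * (p.2 - θ ⬝ᵥ p.1) ^ 2)
    (R : (Fin d → ℝ) → ℝ) (hR : R = fun θ => ∫ p, ℓ θ p ∂P)
    (t : ℝ) (ht : 0 < t) (htc : t < 1 / c)
    (s2 : ℝ)
    (hs2 : s2 = (1 / t) * (c * (d : ℝ) - c * t + 1
      + σx ^ 2 * (∑ i, θstar i ^ 2) / σ ^ 2)) :
    Real.log (∫ q, Real.exp (t * (R q.1 - ℓ q.1 q.2)) ∂(prior.prod P))
      ≤ s2 * t ^ 2 / (2 * (1 - c * t)) := by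
  obtain ⟨v, hv, hP⟩ : ∃ v : NNReal, (v : ℝ) = σ ^ 2 ∧
      P = (Px.prod (gaussianReal 0 v)).map fun p => (p.1, θstar ⬝ᵥ p.1 + p.2) :=
    ⟨_, rfl, hP⟩
  obtain ⟨vp, hvp, hprior⟩ : ∃ v : NNReal, (v : ℝ) = σp ^ 2 ∧
      prior = Measure.pi fun _ : Fin d => gaussianReal 0 v :=
    ⟨_, rfl, hprior⟩
  have hvp0 : vp ≠ 0 := by
    rw [← NNReal.coe_ne_zero, hvp]; positivity
  have hcpos : 0 < c := by rw [hc]; positivity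
  have hct : c * t < 1 := by rw [mul_comm]; exact (lt_div_iff₀ hcpos).1 htc
  have hD : 0 < 1 - c * t := by linarith
  have hmap : Measurable fun p : (Fin d → ℝ) × ℝ => (p.1, θstar ⬝ᵥ p.1 + p.2) := by
    unfold dotProduct; fun_prop
  have hPprob : IsProbabilityMeasure P := by
    rw [hP]; exact Measure.isProbabilityMeasure_map hmap.aemeasurable
  have hpprob : IsProbabilityMeasure prior := by rw [hprior]; infer_instance
  set a : ℝ := t * σx ^ 2 / (2 * σ ^ 2) with ha
  set S : ℝ := ∑ i, θstar i ^ 2 with hS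
  have hSnn : 0 ≤ S := Finset.sum_nonneg fun i _ => sq_nonneg _
  have hac : 2 * a * σp ^ 2 = c * t := by rw [ha, hc]; field_simp
  have hRisk : ∀ θ, R θ = (1 / 2) * Real.log (2 * Real.pi * σ ^ 2)
      + (1 / (2 * σ ^ 2)) * (σx ^ 2 * (∑ i, (θstar i - θ i) ^ 2) + σ ^ 2) := by
    intro θ
    obtain ⟨hint, hval⟩ := integrable_and_integral_sq_dotProduct_add hσx.ne' hmean hcov
      v (θstar - θ)
    have hmeas : Measurable (ℓ θ) := by
      rw [hℓ]; unfold dotProduct; fun_prop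
    rw [hR, hP]
    beta_reduce
    rw [integral_map hmap.aemeasurable hmeas.aestronglyMeasurable, hℓ]
    have hres : ∀ p : (Fin d → ℝ) × ℝ,
        θstar ⬝ᵥ p.1 + p.2 - θ ⬝ᵥ p.1 = (θstar - θ) ⬝ᵥ p.1 + p.2 := fun p => by
      rw [sub_dotProduct]; ring
    simp only [hres]
    rw [integral_add (integrable_const _) (hint.const_mul _),
      integral_const_mul (1 / (2 * σ ^ 2)), hval, hv]
    simp
  have hbound : ∀ q : (Fin d → ℝ) × ((Fin d → ℝ) × ℝ),
      Real.exp (t * (R q.1 - ℓ q.1 q.2))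
        ≤ Real.exp (t / 2) * Real.exp (a * ∑ i, (θstar i - q.1 i) ^ 2) := by
    intro q
    rw [← Real.exp_add, Real.exp_le_exp, hRisk, hℓ]
    have hsq : 0 ≤ t * ((1 / (2 * σ ^ 2)) * (q.2.2 - q.1 ⬝ᵥ q.2.1) ^ 2) := by positivity
    have hsplit : t * ((1 / (2 * σ ^ 2)) * (σx ^ 2 * (∑ i, (θstar i - q.1 i) ^ 2) + σ ^ 2))
        = t / 2 + a * ∑ i, (θstar i - q.1 i) ^ 2 := by
      rw [ha]; field_simp; ring
    beta_reduce
    linarith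
  have hval := integral_exp_sum_sq_pi_gaussianReal (a := a) θstar hvp0 (by rw [hvp, hac]; exact hct)
  rw [← hprior, hvp, hac, ← hS] at hval
  have hint : Integrable (fun θ : Fin d → ℝ => Real.exp (a * ∑ i, (θstar i - θ i) ^ 2)) prior := by
    refine .of_integral_ne_zero ?_
    rw [hval]
    have := Real.sqrt_pos.2 hD
    positivity
  have hle : ∫ q, Real.exp (t * (R q.1 - ℓ q.1 q.2)) ∂(prior.prod P)
      ≤ Real.exp (s2 * t ^ 2 / (2 * (1 - c * t))) := by
    calc _ ≤ ∫ q, Real.exp (t / 2) * Real.exp (a * ∑ i, (θstar i - q.1 i) ^ 2)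
          ∂(prior.prod P) :=
          integral_mono_of_nonneg (.of_forall fun q => (Real.exp_pos _).le)
            ((hint.comp_fst P).const_mul _) (.of_forall hbound)
      _ = Real.exp (t / 2) * (((√(1 - c * t))⁻¹) ^ d * Real.exp (a * S / (1 - c * t))) := by
          rw [integral_const_mul,
            integral_fun_fst (fun θ : Fin d → ℝ => Real.exp (a * ∑ i, (θstar i - θ i) ^ 2)), hval]
          simp
      _ ≤ Real.exp (t / 2) * (Real.exp (c * t / (2 * (1 - c * t))) ^ d
            * Real.exp (a * S / (1 - c * t))) := by
          gcongr
          exact inv_sqrt_one_sub_le_exp hct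
      _ = Real.exp (s2 * t ^ 2 / (2 * (1 - c * t))) := by
          rw [← Real.exp_nat_mul, ← Real.exp_add, ← Real.exp_add, hs2, ha]
          congr 1
          have hDne := hD.ne'
          rw [show c * (d : ℝ) - c * t + 1 = c * d + (1 - c * t) by ring]
          generalize 1 - c * t = D at hDne
          field_simp
          ring
  have hnn : 0 ≤ s2 * t ^ 2 / (2 * (1 - c * t)) := by
    have h1 : 0 ≤ c * (d : ℝ) - c * t + 1 + σx ^ 2 * S / σ ^ 2 := by
      have h2 : 0 ≤ c * (d : ℝ) := by positivity
      have h3 : 0 ≤ σx ^ 2 * S / σ ^ 2 := by positivity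
      linarith
    rw [hs2]
    positivity
  rcases (integral_nonneg (μ := prior.prod P)
    (f := fun q => Real.exp (t * (R q.1 - ℓ q.1 q.2))) fun q => (Real.exp_pos _).le).eq_or_lt with h0 | hpos
  · rw [← h0, Real.log_zero]; exact hnn
  · exact (Real.log_le_iff_le_exp hpos).2 hle
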